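/- arXiv:1610.07359 — 9 statements merged into one kernel-verified Lean document; each statement's English description precedes it below -/
import Mathlib

section
/- Let n ≥ 2. If W is a linear subspace of skew(n) such that q A qᵀ ∈ W for every q ∈ O(n) and every A ∈ W, then W = {0} or W = skew(n). (The conjugation (adjoint) representation of O(n) on skew-symmetric matrices is irreducible.) -/
open Matrix

/-- The space `skew(n)` of skew-symmetric real `n × n` matrices. -/
def Skew (n : ℕ) : Submodule ℝ (Matrix (Fin n) (Fin n) ℝ) where
  carrier := {A | Aᵀ = -A}
  add_mem' := by
    intro a b ha hb
    simp only [Set.mem_setOf_eq] at *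
    rw [Matrix.transpose_add, ha, hb, neg_add]
  zero_mem' := by simp
  smul_mem' := by
    intro c A hA
    simp only [Set.mem_setOf_eq] at *
    rw [Matrix.transpose_smul, hA, smul_neg]

lemma conj_mem {n : ℕ} (q : Matrix (Fin n) (Fin n) ℝ) {A : Matrix (Fin n) (Fin n) ℝ}
    (hA : A ∈ Skew n) : q * A * qᵀ ∈ Skew n := by
  have h : Aᵀ = -A := hA
  show (q * A * qᵀ)ᵀ = -(q * A * qᵀ)
  rw [Matrix.transpose_mul, Matrix.transpose_mul, Matrix.transpose_transpose, h]
  simp [Matrix.mul_assoc]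

/-- Conjugation `A ↦ q A qᵀ` on skew-symmetric matrices. -/
def conjS {n : ℕ} (q : Matrix (Fin n) (Fin n) ℝ) (A : Skew n) : Skew n :=
  ⟨q * A.val * qᵀ, conj_mem q A.2⟩

/-- `x ∧ y := y xᵀ − x yᵀ`. -/
def wedge {n : ℕ} (x y : Fin n → ℝ) : Matrix (Fin n) (Fin n) ℝ :=
  Matrix.vecMulVec y x - Matrix.vecMulVec x y

lemma wedge_mem {n : ℕ} (x y : Fin n → ℝ) : wedge x y ∈ Skew n := by
  show (wedge x y)ᵀ = -(wedge x y)
  ext i j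
  simp [wedge, Matrix.vecMulVec_apply, Matrix.transpose_apply, Matrix.sub_apply, Matrix.neg_apply]
  ring

/-- `x ∧ y` as an element of `skew(n)`. -/
def wedgeS {n : ℕ} (x y : Fin n → ℝ) : Skew n := ⟨wedge x y, wedge_mem x y⟩

lemma comm_mem {n : ℕ} {A B : Matrix (Fin n) (Fin n) ℝ} (hA : A ∈ Skew n) (hB : B ∈ Skew n) :
    A * B - B * A ∈ Skew n := by
  have hA' : Aᵀ = -A := hA
  have hB' : Bᵀ = -B := hB
  show (A * B - B * A)ᵀ = -(A * B - B * A)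
  rw [Matrix.transpose_sub, Matrix.transpose_mul, Matrix.transpose_mul, hA', hB']
  simp [neg_sub]

/-- The commutator `AB − BA` as an element of `skew(n)`. -/
def commS {n : ℕ} (A B : Skew n) : Skew n :=
  ⟨A.val * B.val - B.val * A.val, comm_mem A.2 B.2⟩

lemma diagonal_conj_mem {n : ℕ} {W : Submodule ℝ (Matrix (Fin n) (Fin n) ℝ)}
    (hW : ∀ q : Matrix (Fin n) (Fin n) ℝ, qᵀ * q = 1 → ∀ A ∈ W, q * A * qᵀ ∈ W)
    {d : Fin n → ℝ} (hd : ∀ i, d i * d i = 1) {A : Matrix (Fin n) (Fin n) ℝ} (hA : A ∈ W) :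
    (Matrix.of fun k l => d k * A k l * d l) ∈ W := by
  have h := hW (Matrix.diagonal d) (by simp [Matrix.diagonal_transpose, hd]) A hA
  convert h using 1
  ext k l
  simp [Matrix.diagonal_transpose]

lemma submatrix_perm_mem {n : ℕ} {W : Submodule ℝ (Matrix (Fin n) (Fin n) ℝ)}
    (hW : ∀ q : Matrix (Fin n) (Fin n) ℝ, qᵀ * q = 1 → ∀ A ∈ W, q * A * qᵀ ∈ W)
    (σ : Equiv.Perm (Fin n)) {A : Matrix (Fin n) (Fin n) ℝ} (hA : A ∈ W) :
    A.submatrix σ σ ∈ W := by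
  have h := hW ((1 : Matrix (Fin n) (Fin n) ℝ).submatrix σ id) (by
    rw [Matrix.transpose_submatrix, Matrix.submatrix_mul_equiv]
    simp) A hA
  convert h using 1
  ext k l
  simp [Matrix.mul_apply, Matrix.one_apply]

/-- An `O(n)`-invariant subspace containing a skew-symmetric matrix with nonzero `(i, j)` entry
contains the elementary skew-symmetric matrix supported at `(i, j)` and `(j, i)`. -/
lemma single_sub_single_mem_of_apply_ne_zero {n : ℕ}
    {W : Submodule ℝ (Matrix (Fin n) (Fin n) ℝ)}
    (hW : ∀ q : Matrix (Fin n) (Fin n) ℝ, qᵀ * q = 1 → ∀ A ∈ W, q * A * qᵀ ∈ W)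
    {A : Matrix (Fin n) (Fin n) ℝ} (hA : A ∈ W) (hskew : ∀ k l, A l k = -A k l)
    {i j : Fin n} (hij : i ≠ j) (h : A i j ≠ 0) :
    Matrix.single i j (1 : ℝ) - Matrix.single j i 1 ∈ W := by
  have hsign : ∀ a i : Fin n, (if i = a then (-1 : ℝ) else 1) * (if i = a then -1 else 1) = 1 := by
    intro a i
    split_ifs <;> norm_num
  have h₁ := W.sub_mem hA (diagonal_conj_mem hW (hsign i) hA)
  have h₂ := W.sub_mem h₁ (diagonal_conj_mem hW (hsign j) h₁)
  convert W.smul_mem (4 * A i j)⁻¹ h₂ using 1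
  ext k l
  have hji := hskew i j
  simp only [Matrix.sub_apply, Matrix.smul_apply, Matrix.of_apply, Matrix.single_apply, smul_eq_mul]
  by_cases hki : k = i
  · subst hki
    by_cases hlj : l = j
    · subst hlj
      simp [hij, hij.symm]
      field_simp
      norm_num
    · by_cases hlk : l = k <;> simp [hij, hij.symm, hlj, hlk, Ne.symm hlj]
  by_cases hkj : k = j
  · subst hkj
    by_cases hli : l = i
    · subst hli
      simp [hij, hij.symm, hji]
      field_simp
      norm_num
    · by_cases hlk : l = k <;> simp [hij, hij.symm, hli, hlk, Ne.symm hli]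
  by_cases hli : l = i <;> by_cases hlj : l = j <;>
    simp [hij, hij.symm, hki, hkj, hli, hlj, Ne.symm hki, Ne.symm hkj]

/-- The permutations act transitively on ordered pairs of distinct indices. -/
lemma exists_perm_apply_eq_pair {α : Type*} [DecidableEq α] {i j k l : α} (hij : i ≠ j)
    (hkl : k ≠ l) : ∃ σ : Equiv.Perm α, σ k = i ∧ σ l = j := by
  have hm : Equiv.swap k i l ≠ i := by
    intro h
    have := (Equiv.swap k i).injective (h.trans (Equiv.swap_apply_left k i).symm)
    exact hkl this.symm
  refine ⟨Equiv.swap (Equiv.swap k i l) j * Equiv.swap k i, ?_, ?_⟩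
  · rw [Equiv.Perm.mul_apply, Equiv.swap_apply_left, Equiv.swap_apply_of_ne_of_ne hm.symm hij]
  · rw [Equiv.Perm.mul_apply, Equiv.swap_apply_left]

lemma eq_sum_single_sub_single {n : ℕ} {A : Matrix (Fin n) (Fin n) ℝ}
    (hA : ∀ k l, A l k = -A k l) :
    A = ∑ k, ∑ l, (A k l / 2) • (Matrix.single k l (1 : ℝ) - Matrix.single l k 1) := by
  ext a b
  have h := hA a b
  simp only [Matrix.sum_apply, Matrix.smul_apply, Matrix.sub_apply, Matrix.single_apply,
    smul_eq_mul, mul_sub, Finset.sum_sub_distrib, ite_and, mul_ite, mul_one, mul_zero]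
  simp [h]
  ring

/-- The conjugation (adjoint) representation of `O(n)` on skew-symmetric matrices is
irreducible for `n ≥ 2`: any subspace of `skew(n)` invariant under conjugation by every
orthogonal matrix is `{0}` or all of `skew(n)`. -/
theorem adjoint_rep_of_On_irreducible (n : ℕ) (hn : 2 ≤ n)
    (W : Submodule ℝ (Matrix (Fin n) (Fin n) ℝ)) (hWle : W ≤ Skew n)
    (hW : ∀ q : Matrix (Fin n) (Fin n) ℝ, qᵀ * q = 1 → ∀ A ∈ W, q * A * qᵀ ∈ W) :
    W = ⊥ ∨ W = Skew n := by
  refine or_iff_not_imp_left.mpr fun hne => le_antisymm hWle fun B hB => ?_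
  have hskew : ∀ A ∈ Skew n, ∀ k l, A l k = -A k l := fun A hA k l =>
    congrFun (congrFun (show Aᵀ = -A from hA) k) l
  obtain ⟨A, hA, hA0⟩ := W.exists_mem_ne_zero_of_ne_bot hne
  obtain ⟨i, j, hij0⟩ : ∃ i j, A i j ≠ 0 := by
    by_contra! h
    exact hA0 (Matrix.ext h)
  have hij : i ≠ j := by
    rintro rfl
    exact hij0 (by linarith [hskew A (hWle hA) i i])
  have hS := single_sub_single_mem_of_apply_ne_zero hW hA (hskew A (hWle hA)) hij hij0
  rw [eq_sum_single_sub_single (hskew B hB)]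
  refine W.sum_mem fun k _ => W.sum_mem fun l _ => W.smul_mem _ ?_
  obtain rfl | hkl := eq_or_ne k l
  · simp
  obtain ⟨σ, rfl, rfl⟩ := exists_perm_apply_eq_pair hij hkl
  convert submatrix_perm_mem hW σ hS using 1
  ext a b
  simp [Matrix.single_apply]
end

section
/- Let n ≥ 2. Every linear map ζ : ℝⁿ → skew(n) satisfying ζ(qx) = q ζ(x) qᵀ for all q ∈ O(n) and x ∈ ℝⁿ is identically zero. -/
open Matrix

/-- For `n ≥ 2`, every linear map `ζ : ℝⁿ → skew(n)` that is `O(n)`-equivariant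
(`ζ(qx) = q ζ(x) qᵀ` for all orthogonal `q`) is identically zero. -/
theorem equivariant_map_to_skew_eq_zero (n : ℕ) (hn : 2 ≤ n)
    (ζ : (Fin n → ℝ) →ₗ[ℝ] Skew n)
    (hζ : ∀ q : Matrix (Fin n) (Fin n) ℝ, qᵀ * q = 1 →
        ∀ x : Fin n → ℝ, ζ (q.mulVec x) = conjS q (ζ x)) :
    ζ = 0 := by
  refine LinearMap.ext fun x => ?_
  have h := hζ (-1) (by simp) x
  have hconj : conjS (-1) (ζ x) = ζ x := Subtype.ext (by simp [conjS])
  rw [hconj, Matrix.neg_mulVec, Matrix.one_mulVec, map_neg] at h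
  have : IsAddTorsionFree (Skew n) := .of_isTorsionFree ℝ _
  exact self_eq_neg.mp h.symm
end

section
/- Let n = 3 or n ≥ 5. If W is a linear subspace of skew(n) such that q A qᵀ ∈ W for every q ∈ SO(n) and every A ∈ W, then W = {0} or W = skew(n). (The conjugation representation of SO(n) on skew-symmetric matrices is irreducible for n ≠ 2, 4.) -/
open Matrix

/-- A subspace of matrices invariant under conjugation by `SO(n)`. -/
def SOInvariant {n : ℕ} (W : Submodule ℝ (Matrix (Fin n) (Fin n) ℝ)) : Prop :=
  ∀ q : Matrix (Fin n) (Fin n) ℝ, qᵀ * q = 1 → q.det = 1 → ∀ A ∈ W, q * A * qᵀ ∈ W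

/-- The elementary skew-symmetric matrix with entry `1` at `(i, j)` and `-1` at `(j, i)`. -/
def elemSkew {n : ℕ} (i j : Fin n) : Matrix (Fin n) (Fin n) ℝ :=
  Matrix.single i j 1 - Matrix.single j i 1

/-- The sign vector that is `-1` at `a` and `b` and `1` elsewhere. -/
def signPair {n : ℕ} (a b k : Fin n) : ℝ := if k = a ∨ k = b then -1 else 1

/-- Conjugation by a signed permutation matrix of determinant one preserves `W`. -/
lemma SOInvariant.signed_perm {n : ℕ} {W : Submodule ℝ (Matrix (Fin n) (Fin n) ℝ)}
    (hW : SOInvariant W) (σ : Equiv.Perm (Fin n)) (d : Fin n → ℝ) (hd : ∀ i, d i * d i = 1)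
    (hdet : (Equiv.Perm.sign σ : ℝ) * ∏ i, d i = 1) {A : Matrix (Fin n) (Fin n) ℝ} (hA : A ∈ W) :
    Matrix.of (fun i j => d (σ i) * A (σ i) (σ j) * d (σ j)) ∈ W := by
  have hP : (σ.permMatrix ℝ)ᵀ * σ.permMatrix ℝ = 1 := by
    rw [Matrix.transpose_permMatrix, ← Matrix.permMatrix_mul]
    simp
  have hq := hW (σ.permMatrix ℝ * diagonal d) ?_ ?_ A hA
  · convert hq using 1
    have : σ.permMatrix ℝ * diagonal d * A * (σ.permMatrix ℝ * diagonal d)ᵀ =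
        σ.permMatrix ℝ * (diagonal d * A * diagonal d) * (σ.permMatrix ℝ)ᵀ := by
      simp only [Matrix.transpose_mul, Matrix.diagonal_transpose, Matrix.mul_assoc]
    rw [this]
    ext i j
    rw [Matrix.transpose_permMatrix]
    simp [Equiv.Perm.permMatrix, PEquiv.toMatrix_toPEquiv_mul, PEquiv.mul_toMatrix_toPEquiv,
      show ∀ x, Equiv.symm σ⁻¹ x = σ x from fun _ => rfl]
  · rw [Matrix.transpose_mul, Matrix.mul_assoc, ← Matrix.mul_assoc _ _ (diagonal d), hP,
      Matrix.one_mul, Matrix.diagonal_transpose, Matrix.diagonal_mul_diagonal]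
    simp [hd]
  · rw [Matrix.det_mul, Matrix.det_permutation, Matrix.det_diagonal]
    exact hdet

lemma SOInvariant.signPair_conj {n : ℕ} {W : Submodule ℝ (Matrix (Fin n) (Fin n) ℝ)}
    (hW : SOInvariant W) {a b : Fin n} (hab : a ≠ b) {A : Matrix (Fin n) (Fin n) ℝ} (hA : A ∈ W) :
    Matrix.of (fun i j => signPair a b i * A i j * signPair a b j) ∈ W := by
  refine hW.signed_perm 1 (signPair a b) (fun i => ?_) ?_ hA
  · unfold signPair; split_ifs <;> norm_num
  · have h : ∀ k, signPair a b k = (if k = a then -1 else 1) * (if k = b then -1 else 1) := by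
      intro k
      unfold signPair
      by_cases h1 : k = a <;> by_cases h2 : k = b <;> simp_all
    rw [Finset.prod_congr rfl fun k _ => h k, Finset.prod_mul_distrib]
    simp

/-- The matrix obtained from `A` by adding (for `s = 1`) or subtracting (for `s = -1`) its
conjugate under the sign change `signPair a b`. -/
def signFilter {n : ℕ} (s : ℝ) (a b : Fin n) (A : Matrix (Fin n) (Fin n) ℝ) :
    Matrix (Fin n) (Fin n) ℝ :=
  A + s • Matrix.of (fun i j => signPair a b i * A i j * signPair a b j)

lemma signFilter_apply {n : ℕ} (s : ℝ) (a b : Fin n) (A : Matrix (Fin n) (Fin n) ℝ)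
    (k l : Fin n) :
    signFilter s a b A k l = (1 + s * (signPair a b k * signPair a b l)) * A k l := by
  simp [signFilter]
  ring

lemma SOInvariant.signFilter_mem {n : ℕ} {W : Submodule ℝ (Matrix (Fin n) (Fin n) ℝ)}
    (hW : SOInvariant W) (s : ℝ) {a b : Fin n} (hab : a ≠ b) {A : Matrix (Fin n) (Fin n) ℝ}
    (hA : A ∈ W) : signFilter s a b A ∈ W :=
  W.add_mem hA (W.smul_mem _ (hW.signPair_conj hab hA))

lemma Skew.apply_swap {n : ℕ} {A : Matrix (Fin n) (Fin n) ℝ} (hA : A ∈ Skew n) (i j : Fin n) :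
    A j i = -A i j := congrFun (congrFun (show Aᵀ = -A from hA) i) j

lemma Skew.apply_self {n : ℕ} {A : Matrix (Fin n) (Fin n) ℝ} (hA : A ∈ Skew n) (i : Fin n) :
    A i i = 0 := by
  have := Skew.apply_swap hA i i
  linarith

lemma Skew.eq_smul_elemSkew {n : ℕ} {A : Matrix (Fin n) (Fin n) ℝ} (hA : A ∈ Skew n)
    {i j : Fin n} (hij : i ≠ j)
    (h : ∀ k l, k ≠ l → ¬(k = i ∧ l = j) → ¬(k = j ∧ l = i) → A k l = 0) :
    A = A i j • elemSkew i j := by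
  ext k l
  simp only [elemSkew, Matrix.smul_apply, Matrix.sub_apply, Matrix.single_apply, smul_eq_mul]
  by_cases hkl : k = l
  · subst hkl
    rw [Skew.apply_self hA, if_neg (by grind), if_neg (by grind)]
    simp
  by_cases h1 : k = i ∧ l = j
  · obtain ⟨rfl, rfl⟩ := h1
    rw [if_pos ⟨rfl, rfl⟩, if_neg (by grind)]
    simp
  by_cases h2 : k = j ∧ l = i
  · obtain ⟨rfl, rfl⟩ := h2
    rw [if_neg (by grind), if_pos ⟨rfl, rfl⟩, Skew.apply_swap hA l k]
    simp
  rw [if_neg (by grind), if_neg (by grind), h k l hkl h1 h2]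
  simp

lemma elemSkew_mem_of_forall_eq_zero {n : ℕ} {W : Submodule ℝ (Matrix (Fin n) (Fin n) ℝ)}
    (hWle : W ≤ Skew n) {A : Matrix (Fin n) (Fin n) ℝ} (hA : A ∈ W) {i j : Fin n} (hij : i ≠ j)
    (hne : A i j ≠ 0) (h : ∀ k l, k ≠ l → ¬(k = i ∧ l = j) → ¬(k = j ∧ l = i) → A k l = 0) :
    elemSkew i j ∈ W := by
  rw [Skew.eq_smul_elemSkew (hWle hA) hij h] at hA
  exact (W.smul_mem_iff hne).1 hA

lemma SOInvariant.elemSkew_mem_of_apply_ne_zero {n : ℕ} (hn : n = 3 ∨ 5 ≤ n)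
    {W : Submodule ℝ (Matrix (Fin n) (Fin n) ℝ)} (hW : SOInvariant W) (hWle : W ≤ Skew n)
    {A : Matrix (Fin n) (Fin n) ℝ} (hA : A ∈ W) {i j : Fin n} (hij : i ≠ j) (hne : A i j ≠ 0) :
    elemSkew i j ∈ W := by
  have hA₁ := hW.signFilter_mem 1 hij hA
  rcases hn with rfl | hn
  · refine elemSkew_mem_of_forall_eq_zero hWle hA₁ hij ?_ ?_
    · rw [signFilter_apply]
      simpa [signPair] using hne
    · intro k l hkl h1 h2
      rw [signFilter_apply]
      have : (k = i ∨ k = j) ∧ ¬(l = i ∨ l = j) ∨ ¬(k = i ∨ k = j) ∧ (l = i ∨ l = j) := by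
        grind
      rcases this with ⟨h, h'⟩ | ⟨h, h'⟩ <;> simp [signPair, h, h']
  · obtain ⟨t, ht, htc⟩ : ∃ t ⊆ ({i, j} : Finset (Fin n))ᶜ, t.card = 3 := by
      apply Finset.exists_subset_card_eq
      rw [Finset.card_compl, Finset.card_pair hij, Fintype.card_fin]
      omega
    obtain ⟨a, b, c, hab, hac, hbc, rfl⟩ := Finset.card_eq_three.1 htc
    obtain ⟨hai, haj⟩ : a ≠ i ∧ a ≠ j := by simpa using ht (by simp : a ∈ _)
    obtain ⟨hbi, hbj⟩ : b ≠ i ∧ b ≠ j := by simpa using ht (by simp : b ∈ _)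
    obtain ⟨hci, hcj⟩ : c ≠ i ∧ c ≠ j := by simpa using ht (by simp : c ∈ _)
    have hA₄ := hW.signFilter_mem (-1) hci.symm (hW.signFilter_mem (-1) hbi.symm
      (hW.signFilter_mem (-1) hai.symm hA₁))
    refine elemSkew_mem_of_forall_eq_zero hWle hA₄ hij ?_ ?_
    · simp only [signFilter_apply]
      simp [signPair, hne, hij.symm, haj.symm, hbj.symm, hcj.symm]
    · intro k l hkl h1 h2
      simp only [signFilter_apply, signPair]
      grind

lemma SOInvariant.elemSkew_mem_of_perm {n : ℕ} (hn : 3 ≤ n)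
    {W : Submodule ℝ (Matrix (Fin n) (Fin n) ℝ)} (hW : SOInvariant W) (σ : Equiv.Perm (Fin n))
    {i j : Fin n} (h : elemSkew (σ i) (σ j) ∈ W) : elemSkew i j ∈ W := by
  obtain ⟨m, hm⟩ : ∃ m, m ∉ ({σ i, σ j} : Finset (Fin n)) := by
    by_contra! hall
    have h1 := Finset.card_le_card (fun m _ => hall m : Finset.univ ⊆ _)
    have h2 : ({σ i, σ j} : Finset (Fin n)).card ≤ 2 := Finset.card_le_two
    simp only [Finset.card_univ, Fintype.card_fin] at h1
    omega
  obtain ⟨hmi, hmj⟩ : m ≠ σ i ∧ m ≠ σ j := by simpa using hm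
  have hs : (Equiv.Perm.sign σ : ℝ) * (Equiv.Perm.sign σ : ℝ) = 1 := by
    rcases Int.units_eq_one_or (Equiv.Perm.sign σ) with h | h <;> simp [h]
  have key := hW.signed_perm σ (fun k => if k = m then (Equiv.Perm.sign σ : ℝ) else 1)
    (fun k => by split_ifs <;> simp [hs]) (by simpa using hs) h
  convert key using 1
  ext k l
  simp only [elemSkew, Matrix.of_apply, Matrix.sub_apply, Matrix.single_apply,
    σ.injective.eq_iff]
  grind

lemma SOInvariant.elemSkew_mem {n : ℕ} (hn : 3 ≤ n)
    {W : Submodule ℝ (Matrix (Fin n) (Fin n) ℝ)} (hW : SOInvariant W)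
    {i j : Fin n} (hij : i ≠ j) (h : elemSkew i j ∈ W) (k l : Fin n) : elemSkew k l ∈ W := by
  by_cases hkl : k = l
  · subst hkl
    simp [elemSkew]
  · have h1 : elemSkew k (Equiv.swap i k j) ∈ W :=
      hW.elemSkew_mem_of_perm hn (Equiv.swap i k) (by simpa using h)
    refine hW.elemSkew_mem_of_perm hn (Equiv.swap (Equiv.swap i k j) l) ?_
    have h2 : k ≠ Equiv.swap i k j := by
      intro h
      have := congrArg (Equiv.swap i k) h
      simp at this
      exact hij this
    rwa [Equiv.swap_apply_of_ne_of_ne h2 hkl, Equiv.swap_apply_right]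

lemma Skew.eq_sum_elemSkew {n : ℕ} {A : Matrix (Fin n) (Fin n) ℝ} (hA : A ∈ Skew n) :
    A = (1 / 2 : ℝ) • ∑ i, ∑ j, A i j • elemSkew i j := by
  ext k l
  have := Skew.apply_swap hA k l
  simp [elemSkew, Matrix.sum_apply, Matrix.single_apply, mul_sub, Finset.sum_sub_distrib,
    ite_and, this]
  ring

/-- The conjugation representation of `SO(n)` on skew-symmetric matrices is irreducible
for `n = 3` and all `n ≥ 5`: any subspace of `skew(n)` invariant under conjugation by every
special orthogonal matrix is `{0}` or all of `skew(n)`. -/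
theorem adjoint_rep_of_SOn_irreducible (n : ℕ) (hn : n = 3 ∨ 5 ≤ n)
    (W : Submodule ℝ (Matrix (Fin n) (Fin n) ℝ)) (hWle : W ≤ Skew n)
    (hW : ∀ q : Matrix (Fin n) (Fin n) ℝ, qᵀ * q = 1 → q.det = 1 →
        ∀ A ∈ W, q * A * qᵀ ∈ W) :
    W = ⊥ ∨ W = Skew n := by
  have hinv : SOInvariant W := hW
  by_cases hbot : W = ⊥
  · exact Or.inl hbot
  obtain ⟨A, hA, hA0⟩ := W.ne_bot_iff.1 hbot
  obtain ⟨i, j, hne⟩ : ∃ i j, A i j ≠ 0 := by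
    by_contra! h
    exact hA0 (Matrix.ext h)
  have hij : i ≠ j := by
    rintro rfl
    exact hne (Skew.apply_self (hWle hA) i)
  have hmem := hinv.elemSkew_mem (by omega) hij
    (hinv.elemSkew_mem_of_apply_ne_zero hn hWle hA hij hne)
  refine Or.inr (le_antisymm hWle fun B hB => ?_)
  rw [Skew.eq_sum_elemSkew hB]
  exact W.smul_mem _ (W.sum_mem fun k _ => W.sum_mem fun l _ => W.smul_mem _ (hmem k l))
end

section
/- Let n ≥ 2 with n ≠ 3. Every linear map ζ : ℝⁿ → skew(n) satisfying ζ(qx) = q ζ(x) qᵀ for all q ∈ SO(n) and x ∈ ℝⁿ is identically zero. -/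
open Matrix

/-- The diagonal of the matrix that changes the sign of the coordinates `a` and `b`. -/
def pairSign {n : ℕ} (a b i : Fin n) : ℝ :=
  (if i = a then -1 else 1) * (if i = b then -1 else 1)

lemma pairSign_mul_self {n : ℕ} (a b i : Fin n) : pairSign a b i * pairSign a b i = 1 := by
  unfold pairSign
  split_ifs <;> norm_num

lemma diagonal_pairSign_orthogonal {n : ℕ} (a b : Fin n) :
    (diagonal (pairSign a b))ᵀ * diagonal (pairSign a b) = 1 := by
  rw [diagonal_transpose, diagonal_mul_diagonal, ← diagonal_one]
  congr 1
  funext i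
  exact pairSign_mul_self a b i

lemma det_diagonal_pairSign {n : ℕ} (a b : Fin n) : (diagonal (pairSign a b)).det = 1 := by
  simp only [det_diagonal, pairSign, Finset.prod_mul_distrib]
  simp

lemma pairSign_mul_apply_single {n : ℕ} (ζ : (Fin n → ℝ) →ₗ[ℝ] Skew n)
    (hζ : ∀ q : Matrix (Fin n) (Fin n) ℝ, qᵀ * q = 1 → q.det = 1 →
        ∀ x : Fin n → ℝ, ζ (q.mulVec x) = conjS q (ζ x)) (a b k i j : Fin n) :
    pairSign a b k * (ζ (Pi.single k 1)).val i j =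
      pairSign a b i * (ζ (Pi.single k 1)).val i j * pairSign a b j := by
  have h := hζ _ (diagonal_pairSign_orthogonal a b) (det_diagonal_pairSign a b) (Pi.single k 1)
  have hk : (diagonal (pairSign a b)).mulVec (Pi.single k 1) =
      pairSign a b k • (Pi.single k 1 : Fin n → ℝ) := by
    ext l
    rw [mulVec_diagonal]
    by_cases hl : l = k
    · subst hl
      simp
    · simp [hl]
  rw [hk, map_smul] at h
  have hij := congrArg (fun A : Skew n => A.val i j) h
  simpa [conjS, diagonal_transpose, mul_diagonal, diagonal_mul] using hij

/-- The signs of `k`, `i`, `j` can be changed so that their product becomes `-1`. -/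
lemma exists_pairSign_prod_eq_neg_one {n : ℕ} (hn3 : n ≠ 3) (k i j : Fin n) (hij : i ≠ j) :
    ∃ a b : Fin n, pairSign a b i * pairSign a b j * pairSign a b k = -1 := by
  by_cases hk : k = i ∨ k = j
  · refine ⟨i, j, ?_⟩
    rcases hk with rfl | rfl <;> simp [pairSign, hij, hij.symm]
  · push Not at hk
    obtain ⟨hki, hkj⟩ := hk
    have hcard : ({k, i, j} : Finset (Fin n)).card = 3 := Finset.card_eq_three.mpr
      ⟨k, i, j, hki, hkj, hij, rfl⟩
    obtain ⟨b, hb⟩ : ∃ b, b ∉ ({k, i, j} : Finset (Fin n)) := by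
      by_contra! hall
      rw [Finset.eq_univ_iff_forall.mpr hall, Finset.card_univ, Fintype.card_fin] at hcard
      exact hn3 hcard
    simp only [Finset.mem_insert, Finset.mem_singleton, not_or] at hb
    obtain ⟨hbk, hbi, hbj⟩ := hb
    exact ⟨k, b, by simp [pairSign, hki.symm, hkj.symm, Ne.symm hbk, Ne.symm hbi, Ne.symm hbj]⟩

/-- For `n ≥ 2`, `n ≠ 3`, every linear map `ζ : ℝⁿ → skew(n)` that is `SO(n)`-equivariant
(`ζ(qx) = q ζ(x) qᵀ` for all special orthogonal `q`) is identically zero. -/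
theorem so_equivariant_map_to_skew_eq_zero (n : ℕ) (hn : 2 ≤ n) (hn3 : n ≠ 3)
    (ζ : (Fin n → ℝ) →ₗ[ℝ] Skew n)
    (hζ : ∀ q : Matrix (Fin n) (Fin n) ℝ, qᵀ * q = 1 → q.det = 1 →
        ∀ x : Fin n → ℝ, ζ (q.mulVec x) = conjS q (ζ x)) :
    ζ = 0 := by
  refine LinearMap.pi_ext' fun k => LinearMap.ext_ring (Subtype.ext (Matrix.ext fun i j => ?_))
  change (ζ (Pi.single k 1)).val i j = 0
  by_cases hij : i = j
  · subst hij
    have hA : (ζ (Pi.single k 1)).valᵀ = -(ζ (Pi.single k 1)).val := (ζ (Pi.single k 1)).2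
    have h := congrFun (congrFun hA i) i
    rw [transpose_apply, neg_apply] at h
    linarith
  · obtain ⟨a, b, hab⟩ := exists_pairSign_prod_eq_neg_one hn3 k i j hij
    have h := pairSign_mul_apply_single ζ hζ a b k i j
    have hk := pairSign_mul_self a b k
    linear_combination (1 / 2 : ℝ) * pairSign a b k * h +
      (1 / 2 : ℝ) * (ζ (Pi.single k 1)).val i j * (hab - hk)
end

section
/- Let n ≥ 2 and let T : skew(n) × ℝⁿ → ℝⁿ be a bilinear map such that q·T(A, x) = T(qAqᵀ, qx) for every q ∈ O(n), A ∈ skew(n) and x ∈ ℝⁿ. Then there exists a constant c ∈ ℝ such that T(A, x) = c·(A x) (matrix-vector product) for all A and x. -/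
open Matrix

lemma conjS_wedgeS {n : ℕ} (q : Matrix (Fin n) (Fin n) ℝ) (x y : Fin n → ℝ) :
    conjS q (wedgeS x y) = wedgeS (q *ᵥ x) (q *ᵥ y) := by
  apply Subtype.ext
  simp [conjS, wedgeS, wedge, mul_sub, sub_mul, mul_vecMulVec, vecMulVec_mul, vecMul_transpose]

lemma coe_wedgeS {n : ℕ} (x y : Fin n → ℝ) : (wedgeS x y : Matrix (Fin n) (Fin n) ℝ) = wedge x y :=
  rfl

lemma wedgeS_smul_smul {n : ℕ} (a b : ℝ) (x y : Fin n → ℝ) :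
    wedgeS (a • x) (b • y) = (a * b) • wedgeS x y := by
  apply Subtype.ext
  ext i j
  simp [wedgeS, wedge, vecMulVec_apply]
  ring

lemma wedgeS_swap {n : ℕ} (x y : Fin n → ℝ) : wedgeS y x = -wedgeS x y := by
  apply Subtype.ext
  simp [wedgeS, wedge]

lemma wedge_mulVec {n : ℕ} (x y v : Fin n → ℝ) :
    wedge x y *ᵥ v = (x ⬝ᵥ v) • y - (y ⬝ᵥ v) • x := by
  simp [wedge, sub_mulVec, vecMulVec_mulVec]

lemma skew_eq_sum_wedgeS {n : ℕ} (A : Skew n) :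
    A = ∑ i, ∑ j, (A.val j i / 2) • wedgeS (Pi.single i (1 : ℝ)) (Pi.single j (1 : ℝ)) := by
  apply Subtype.ext
  ext a b
  have h : A.val b a = -A.val a b := congrFun (congrFun A.2 a) b
  simp [wedgeS, wedge, Matrix.sum_apply, vecMulVec_apply, Pi.single_apply, mul_sub,
    Finset.sum_sub_distrib, h]
  ring

lemma exists_perm_map_pair {α : Type*} [DecidableEq α] {i j k l : α} (hij : i ≠ j) (hkl : k ≠ l) :
    ∃ σ : Equiv.Perm α, σ i = k ∧ σ j = l := by
  have h : Equiv.swap i k j ≠ k := by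
    rw [Ne, Equiv.swap_apply_eq_iff, Equiv.swap_apply_right]
    exact hij.symm
  exact ⟨(Equiv.swap i k).trans (Equiv.swap (Equiv.swap i k j) l),
    by simp [Equiv.swap_apply_of_ne_of_ne h.symm hkl], by simp⟩

/-- Equivariance under diagonal sign matrices. -/
lemma equivariant_coeff_sign {n : ℕ}
    {T : Skew n →ₗ[ℝ] (Fin n → ℝ) →ₗ[ℝ] (Fin n → ℝ)}
    (hT : ∀ q : Matrix (Fin n) (Fin n) ℝ, qᵀ * q = 1 →
      ∀ (A : Skew n) (x : Fin n → ℝ), q.mulVec (T A x) = T (conjS q A) (q.mulVec x))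
    (s : Fin n → ℝ) (hs : ∀ i, s i * s i = 1) (i j k l : Fin n) :
    s l * T (wedgeS (Pi.single i 1) (Pi.single j 1)) (Pi.single k 1) l =
      s i * s j * s k * T (wedgeS (Pi.single i 1) (Pi.single j 1)) (Pi.single k 1) l := by
  have hq : (diagonal s)ᵀ * diagonal s = 1 := by simp [hs]
  have hsingle (m : Fin n) : diagonal s *ᵥ Pi.single m 1 = s m • Pi.single m (1 : ℝ) := by
    ext a
    simp [mulVec_diagonal, Pi.single_apply]
    grind
  have h := congrFun (hT _ hq (wedgeS (Pi.single i 1) (Pi.single j 1)) (Pi.single k 1)) l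
  rw [conjS_wedgeS, hsingle, hsingle, hsingle, wedgeS_smul_smul] at h
  simpa [mulVec_diagonal, mul_assoc, mul_left_comm] using h

/-- Equivariance under permutation matrices. -/
lemma equivariant_coeff_perm {n : ℕ}
    {T : Skew n →ₗ[ℝ] (Fin n → ℝ) →ₗ[ℝ] (Fin n → ℝ)}
    (hT : ∀ q : Matrix (Fin n) (Fin n) ℝ, qᵀ * q = 1 →
      ∀ (A : Skew n) (x : Fin n → ℝ), q.mulVec (T A x) = T (conjS q A) (q.mulVec x))
    (σ : Equiv.Perm (Fin n)) (i j k l : Fin n) :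
    T (wedgeS (Pi.single (σ i) 1) (Pi.single (σ j) 1)) (Pi.single (σ k) 1) (σ l) =
      T (wedgeS (Pi.single i 1) (Pi.single j 1)) (Pi.single k 1) l := by
  let q : Matrix (Fin n) (Fin n) ℝ := (1 : Matrix _ _ ℝ).submatrix σ.symm id
  have hmul (v : Fin n → ℝ) : q *ᵥ v = v ∘ σ.symm := by
    ext a
    simp [q, mulVec, dotProduct, one_apply]
  have hq : qᵀ * q = 1 := by
    ext a b
    simp [q, mul_apply, one_apply, Equiv.symm_apply_eq]
  have hsingle (m : Fin n) : q *ᵥ Pi.single m 1 = Pi.single (σ m) (1 : ℝ) := by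
    rw [hmul]
    ext a
    simp [Pi.single_apply, Equiv.symm_apply_eq]
  have h := congrFun (hT q hq (wedgeS (Pi.single i 1) (Pi.single j 1)) (Pi.single k 1)) (σ l)
  rw [conjS_wedgeS, hsingle, hsingle, hsingle, hmul] at h
  simpa using h.symm

/-- A coefficient in which some index occurs an odd number of times vanishes. -/
lemma equivariant_coeff_eq_zero {n : ℕ}
    {T : Skew n →ₗ[ℝ] (Fin n → ℝ) →ₗ[ℝ] (Fin n → ℝ)}
    (hT : ∀ q : Matrix (Fin n) (Fin n) ℝ, qᵀ * q = 1 →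
      ∀ (A : Skew n) (x : Fin n → ℝ), q.mulVec (T A x) = T (conjS q A) (q.mulVec x))
    {i j k l : Fin n} (hij : i ≠ j)
    (h₁ : ¬(k = i ∧ l = j)) (h₂ : ¬(k = j ∧ l = i)) :
    T (wedgeS (Pi.single i 1) (Pi.single j 1)) (Pi.single k 1) l = 0 := by
  have key (m : Fin n) := equivariant_coeff_sign hT (fun a => if a = m then -1 else 1)
    (fun a => by split_ifs <;> norm_num) i j k l
  have hi := key i
  have hj := key j
  have hk := key k
  grind

/-- Lemma (b) on invariant tensors: for `n ≥ 2`, every bilinear map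
`T : skew(n) × ℝⁿ → ℝⁿ` satisfying `q T(A, x) = T(qAqᵀ, qx)` for every `q ∈ O(n)` is of the
form `T(A, x) = c·(Ax)` for some constant `c`. -/
theorem equivariant_bilinear_skew_vector_is_mulVec (n : ℕ) (hn : 2 ≤ n)
    (T : Skew n →ₗ[ℝ] (Fin n → ℝ) →ₗ[ℝ] (Fin n → ℝ))
    (hT : ∀ q : Matrix (Fin n) (Fin n) ℝ, qᵀ * q = 1 →
        ∀ (A : Skew n) (x : Fin n → ℝ), q.mulVec (T A x) = T (conjS q A) (q.mulVec x)) :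
    ∃ c : ℝ, ∀ (A : Skew n) (x : Fin n → ℝ), T A x = c • (A.val.mulVec x) := by
  let i₀ : Fin n := ⟨0, by omega⟩
  let j₀ : Fin n := ⟨1, by omega⟩
  have h₀ : i₀ ≠ j₀ := by simp [i₀, j₀]
  let c := T (wedgeS (Pi.single i₀ 1) (Pi.single j₀ 1)) (Pi.single i₀ 1) j₀
  have hc (i j : Fin n) (hij : i ≠ j) :
      T (wedgeS (Pi.single i 1) (Pi.single j 1)) (Pi.single i 1) j = c := by
    obtain ⟨σ, rfl, rfl⟩ := exists_perm_map_pair h₀ hij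
    exact equivariant_coeff_perm hT σ i₀ j₀ i₀ j₀
  have hbasis (i j k : Fin n) :
      T (wedgeS (Pi.single i 1) (Pi.single j 1)) (Pi.single k 1) =
        c • (wedge (Pi.single i 1) (Pi.single j 1) *ᵥ Pi.single k 1) := by
    by_cases hij : i = j
    · subst hij
      have h : wedgeS (Pi.single i (1 : ℝ)) (Pi.single i 1) = 0 := by
        apply Subtype.ext
        simp [wedgeS, wedge]
      rw [h, wedge_mulVec]
      simp
    ext l
    rw [wedge_mulVec]
    by_cases h₁ : k = i ∧ l = j
    · obtain ⟨rfl, rfl⟩ := h₁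
      simp [hc _ _ hij, hij]
    by_cases h₂ : k = j ∧ l = i
    · obtain ⟨rfl, rfl⟩ := h₂
      rw [wedgeS_swap]
      simp [hc _ _ (Ne.symm hij), hij]
    rw [equivariant_coeff_eq_zero hT hij h₁ h₂]
    by_cases hi : k = i <;> by_cases hj : k = j <;> simp_all
  refine ⟨c, fun A x => ?_⟩
  have hwedge (i j : Fin n) : T (wedgeS (Pi.single i 1) (Pi.single j 1)) =
      c • (wedge (Pi.single i 1) (Pi.single j 1)).mulVecLin := by
    refine (Pi.basisFun ℝ (Fin n)).ext fun k => ?_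
    simpa using hbasis i j k
  rw [skew_eq_sum_wedgeS A]
  simp only [map_sum, map_smul, LinearMap.sum_apply, LinearMap.smul_apply, hwedge,
    mulVecLin_apply, AddSubmonoidClass.coe_finsetSum, SetLike.val_smul, coe_wedgeS,
    sum_mulVec, smul_mulVec, Finset.smul_sum, smul_comm c]
end

section
/- Let n ≥ 2 and let S be a linear map from skew(n) to the space of symmetric n×n real matrices such that S(qAqᵀ) = q S(A) qᵀ for every q ∈ O(n) and A ∈ skew(n). Then S is identically zero. -/
open Matrix

/-- Every skew-symmetric matrix is a combination of wedges of standard basis vectors. -/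
lemma eq_sum_smul_wedgeS {n : ℕ} (A : Skew n) :
    A = ∑ i, ∑ j, (A.val i j / 2) • wedgeS (Pi.single j (1 : ℝ)) (Pi.single i 1) := by
  have hA : A.valᵀ = -A.val := A.2
  refine Subtype.ext (Matrix.ext fun k l => ?_)
  have h : A.val l k = -A.val k l := congrFun (congrFun hA k) l
  simp [wedgeS, wedge, Matrix.sum_apply, Matrix.vecMulVec_apply, Pi.single_apply, mul_sub,
    Finset.sum_sub_distrib, h]
  ring

/-- A symmetric-matrix-valued equivariant map vanishes on wedges of distinct basis vectors. -/
lemma equivariant_wedgeS_single_eq_zero {n : ℕ}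
    (S : Skew n →ₗ[ℝ] Matrix (Fin n) (Fin n) ℝ)
    (hsym : ∀ A : Skew n, (S A)ᵀ = S A)
    (hS : ∀ q : Matrix (Fin n) (Fin n) ℝ, qᵀ * q = 1 →
        ∀ A : Skew n, S (conjS q A) = q * S A * qᵀ)
    {i j : Fin n} (hij : i ≠ j) :
    S (wedgeS (Pi.single i 1) (Pi.single j 1)) = 0 := by
  set E := wedgeS (Pi.single i (1 : ℝ)) (Pi.single j 1) with hE
  have hflip : ∀ m, (m = i ∨ m = j) → ∀ k l,
      (if k = m then -1 else 1) * S E k l * (if l = m then -1 else 1) = -S E k l := by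
    intro m hm k l
    let d : Fin n → ℝ := fun a => if a = m then -1 else 1
    have hd : (diagonal d)ᵀ * diagonal d = 1 := by
      rw [diagonal_transpose, diagonal_mul_diagonal, ← diagonal_one]
      congr 1
      ext a
      by_cases h : a = m <;> simp [d, h]
    have hconj : conjS (diagonal d) E = -E := by
      rw [hE, conjS_wedgeS]
      refine Subtype.ext (Matrix.ext fun a b => ?_)
      rcases hm with rfl | rfl <;>
        simp [wedgeS, wedge, vecMulVec_apply, d, hij, hij.symm,
          Pi.single_neg] <;> ring
    have h := congrFun (congrFun (hS _ hd E) k) l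
    rw [hconj, map_neg, diagonal_transpose, mul_diagonal, diagonal_mul] at h
    exact h.symm
  have hentry : S E i j = 0 := by
    let q := (Equiv.swap i j).permMatrix ℝ
    have hq : qᵀ * q = 1 := by
      simp [q, ← Matrix.permMatrix_mul]
    have hi : q *ᵥ Pi.single i 1 = Pi.single j 1 := by
      ext a
      simp [q, Pi.single_apply, Equiv.swap_apply_eq_iff]
    have hj : q *ᵥ Pi.single j 1 = Pi.single i 1 := by
      ext a
      simp [q, Pi.single_apply, Equiv.swap_apply_eq_iff]
    have h := congrFun (congrFun (hS q hq E) i) j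
    have hval : (q * S E * qᵀ) i j = S E j i := by
      simp [q, Equiv.Perm.permMatrix, PEquiv.toMatrix_toPEquiv_mul, ← PEquiv.toMatrix_symm,
        ← Equiv.toPEquiv_symm, PEquiv.mul_toMatrix_toPEquiv]
    have hs : S E j i = S E i j := congrFun (congrFun (hsym E) i) j
    rw [hval, hs, hE, conjS_wedgeS, hi, hj, wedgeS_swap, map_neg, Matrix.neg_apply] at h
    linarith
  have hentry' : S E j i = 0 := (congrFun (congrFun (hsym E) i) j).trans hentry
  ext k l
  have h₁ := hflip i (Or.inl rfl) k l
  have h₂ := hflip j (Or.inr rfl) k l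
  simp only [Matrix.zero_apply]
  split_ifs at h₁ h₂ <;> grind

/-- For `n ≥ 2`, every linear map `S` from `skew(n)` to symmetric matrices satisfying
`S(qAqᵀ) = q S(A) qᵀ` for every `q ∈ O(n)` is identically zero. -/
theorem equivariant_map_skew_to_sym_eq_zero (n : ℕ) (hn : 2 ≤ n)
    (S : Skew n →ₗ[ℝ] Matrix (Fin n) (Fin n) ℝ)
    (hsym : ∀ A : Skew n, (S A)ᵀ = S A)
    (hS : ∀ q : Matrix (Fin n) (Fin n) ℝ, qᵀ * q = 1 →
        ∀ A : Skew n, S (conjS q A) = q * S A * qᵀ) :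
    ∀ A : Skew n, S A = 0 := by
  intro A
  rw [eq_sum_smul_wedgeS A]
  simp only [map_sum, map_smul]
  refine Finset.sum_eq_zero fun i _ => Finset.sum_eq_zero fun j _ => ?_
  rcases eq_or_ne j i with rfl | hji
  · have h : wedgeS (Pi.single j (1 : ℝ)) (Pi.single j 1) = 0 :=
      Subtype.ext (by simp [wedgeS, wedge])
    rw [h, map_zero, smul_zero]
  · rw [equivariant_wedgeS_single_eq_zero S hsym hS hji, smul_zero]
end

section
/- Let n ≥ 2 and let W : skew(n) × skew(n) → skew(n) be an alternating bilinear map such that q W(A, B) qᵀ = W(qAqᵀ, qBqᵀ) for every q ∈ O(n) and A, B ∈ skew(n). Then there exists a constant c ∈ ℝ such that W(A, B) = c·(AB − BA) for all A, B ∈ skew(n). -/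
open Matrix

lemma skew_apply_swap {n : ℕ} (A : Skew n) (i j : Fin n) : A.val j i = -A.val i j :=
  congrFun (congrFun A.2 i) j

/-- The wedge `eᵢ ∧ eⱼ` of two standard basis vectors. -/
def basisWedge {n : ℕ} (i j : Fin n) : Skew n := wedgeS (Pi.single i 1) (Pi.single j 1)

lemma skew_eq_sum_basisWedge {n : ℕ} (A : Skew n) :
    A = ∑ i, ∑ j, (A.val j i / 2) • basisWedge i j := by
  apply Subtype.ext
  ext p q
  simp only [AddSubmonoidClass.coe_finsetSum, Matrix.sum_apply, Submodule.coe_smul,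
    Matrix.smul_apply, basisWedge, wedgeS, wedge, Matrix.sub_apply, Matrix.vecMulVec_apply,
    smul_eq_mul, mul_sub, Finset.sum_sub_distrib, Pi.single_apply]
  simp [skew_apply_swap A p q]
  ring

lemma basisWedge_swap {n : ℕ} (i j : Fin n) : basisWedge j i = -basisWedge i j :=
  wedgeS_swap _ _

/-- A bilinear map on `skew(n)` is zero once it vanishes on wedges of basis vectors. -/
lemma eq_zero_of_basisWedge {n : ℕ} (W : Skew n →ₗ[ℝ] Skew n →ₗ[ℝ] Skew n)
    (h : ∀ i j k l, W (basisWedge i j) (basisWedge k l) = 0) : W = 0 := by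
  ext1 A
  ext1 B
  rw [skew_eq_sum_basisWedge A, skew_eq_sum_basisWedge B]
  simp [h]

/-- `W` commutes with conjugation by every orthogonal matrix. -/
def IsConjEquivariant {n : ℕ} (W : Skew n →ₗ[ℝ] Skew n →ₗ[ℝ] Skew n) : Prop :=
  ∀ q : Matrix (Fin n) (Fin n) ℝ, qᵀ * q = 1 →
    ∀ A B : Skew n, conjS q (W A B) = W (conjS q A) (conjS q B)

/-- The coordinates of a bilinear map on `skew(n)` with respect to the wedges `eᵢ ∧ eⱼ`. -/
def wedgeCoeff {n : ℕ} (W : Skew n →ₗ[ℝ] Skew n →ₗ[ℝ] Skew n) (i j k l p q : Fin n) : ℝ :=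
  (W (basisWedge i j) (basisWedge k l)).val p q

lemma IsConjEquivariant.wedgeCoeff_sign {n : ℕ} {W : Skew n →ₗ[ℝ] Skew n →ₗ[ℝ] Skew n}
    (hW : IsConjEquivariant W) {s : Fin n → ℝ} (hs : ∀ a, s a * s a = 1) (i j k l p q : Fin n) :
    s p * s q * wedgeCoeff W i j k l p q = s i * s j * (s k * s l) * wedgeCoeff W i j k l p q := by
  have hconj (i j : Fin n) :
      conjS (Matrix.diagonal s) (basisWedge i j) = (s i * s j) • basisWedge i j := by
    have hs' (a : Fin n) : Matrix.diagonal s *ᵥ Pi.single a 1 = s a • Pi.single a 1 := by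
      ext b
      by_cases h : b = a <;> simp [Matrix.mulVec_diagonal, h]
    rw [basisWedge, conjS_wedgeS, hs', hs', wedgeS_smul_smul]
  have h := hW (Matrix.diagonal s) (by simp [Matrix.diagonal_mul_diagonal, hs])
    (basisWedge i j) (basisWedge k l)
  rw [hconj, hconj] at h
  have h' := congrArg (fun M : Skew n => M.val p q) h
  simp [conjS, Matrix.diagonal_mul, Matrix.mul_diagonal] at h'
  simp only [wedgeCoeff]
  linarith

lemma IsConjEquivariant.wedgeCoeff_perm {n : ℕ} {W : Skew n →ₗ[ℝ] Skew n →ₗ[ℝ] Skew n}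
    (hW : IsConjEquivariant W) (σ : Equiv.Perm (Fin n)) (i j k l p q : Fin n) :
    wedgeCoeff W (σ i) (σ j) (σ k) (σ l) (σ p) (σ q) = wedgeCoeff W i j k l p q := by
  have hconj (i j : Fin n) :
      conjS (Equiv.Perm.permMatrix ℝ σ⁻¹) (basisWedge i j) = basisWedge (σ i) (σ j) := by
    have hs' (a : Fin n) : Equiv.Perm.permMatrix ℝ σ⁻¹ *ᵥ Pi.single a 1 = Pi.single (σ a) 1 := by
      ext b
      simp [Pi.single_apply, Equiv.Perm.inv_def, Equiv.symm_apply_eq]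
    rw [basisWedge, conjS_wedgeS, hs', hs', basisWedge]
  have h := hW (Equiv.Perm.permMatrix ℝ σ⁻¹)
    (by rw [Matrix.transpose_permMatrix, ← Matrix.permMatrix_mul]; simp)
    (basisWedge i j) (basisWedge k l)
  rw [hconj, hconj] at h
  rw [wedgeCoeff, ← h]
  simp only [conjS, wedgeCoeff, Matrix.transpose_permMatrix, inv_inv, Equiv.Perm.permMatrix,
    PEquiv.toMatrix_toPEquiv_mul, PEquiv.mul_toMatrix_toPEquiv, Matrix.submatrix_apply]
  simp

/-- A six-index tensor that is antisymmetric in three pairs of indices and invariant under sign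
changes of the basis vectors is determined by its entries `F a b b d a d`. -/
lemma eq_zero_of_sign_invariant {ι : Type*} [DecidableEq ι] {F : ι → ι → ι → ι → ι → ι → ℝ}
    (h₁ : ∀ i j k l p q, F j i k l p q = -F i j k l p q)
    (h₂ : ∀ i j k l p q, F i j l k p q = -F i j k l p q)
    (h₃ : ∀ i j k l p q, F i j k l q p = -F i j k l p q)
    (hs : ∀ s : ι → ℝ, (∀ a, s a * s a = 1) → ∀ i j k l p q,
      s p * s q * F i j k l p q = s i * s j * (s k * s l) * F i j k l p q)
    (h : ∀ a b d, a ≠ b → b ≠ d → a ≠ d → F a b b d a d = 0) (i j k l p q : ι) :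
    F i j k l p q = 0 := by
  by_contra hF
  have hij : i ≠ j := by rintro rfl; exact hF (by linarith [h₁ i i k l p q])
  have hkl : k ≠ l := by rintro rfl; exact hF (by linarith [h₂ i j k k p q])
  have hpq : p ≠ q := by rintro rfl; exact hF (by linarith [h₃ i j k l p p])
  have key (a : ι) := mul_right_cancel₀ hF
    (hs (fun b => if b = a then -1 else 1) (by intro b; split_ifs <;> norm_num)
      i j k l p q)
  have ki := key i
  have kj := key j
  have kk := key k
  have kp := key p
  have kq := key q
  clear key hs
  grind

/-- An equivariant bilinear map is zero once it has one vanishing coordinate of the form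
`wedgeCoeff W a b b d a d`, or if there are no three distinct indices. -/
lemma IsConjEquivariant.eq_zero {n : ℕ} {W : Skew n →ₗ[ℝ] Skew n →ₗ[ℝ] Skew n}
    (hW : IsConjEquivariant W) (h : Nonempty (Fin 3 ↪ Fin n) → ∃ y : Fin 3 ↪ Fin n,
      wedgeCoeff W (y 0) (y 1) (y 1) (y 2) (y 0) (y 2) = 0) : W = 0 := by
  refine eq_zero_of_basisWedge W fun i j k l => ?_
  apply Subtype.ext
  ext p q
  refine eq_zero_of_sign_invariant (F := wedgeCoeff W) ?_ ?_ ?_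
    (fun s hs => hW.wedgeCoeff_sign hs) ?_ i j k l p q
  · intro i j k l p q
    simp [wedgeCoeff, basisWedge_swap i j]
  · intro i j k l p q
    simp [wedgeCoeff, basisWedge_swap k l]
  · intro i j k l p q
    exact skew_apply_swap _ _ _
  · intro a b d hab hbd had
    let x : Fin 3 ↪ Fin n := ⟨![a, b, d], by
      intro u v
      fin_cases u <;> fin_cases v <;> simp [hab, hbd, had, hab.symm, hbd.symm, had.symm]⟩
    obtain ⟨y, hy⟩ := h ⟨x⟩
    obtain ⟨σ, hσ⟩ := (Equiv.Perm.isMultiplyPretransitive (Fin n) 3).exists_smul_eq y x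
    have hσ' (u : Fin 3) : σ (y u) = x u := congrArg (fun z : Fin 3 ↪ Fin n => z u) hσ
    rw [← hW.wedgeCoeff_perm σ, hσ', hσ', hσ'] at hy
    exact hy

/-- The commutator as a bilinear map on `skew(n)`. -/
def commBilin (n : ℕ) : Skew n →ₗ[ℝ] Skew n →ₗ[ℝ] Skew n :=
  LinearMap.mk₂ ℝ commS
    (fun A B C => Subtype.ext (by simp [commS, Matrix.add_mul, Matrix.mul_add]; abel))
    (fun r A B => Subtype.ext (by simp [commS, smul_sub]))
    (fun A B C => Subtype.ext (by simp [commS, Matrix.add_mul, Matrix.mul_add]; abel))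
    (fun r A B => Subtype.ext (by simp [commS, smul_sub]))

lemma conjS_commS {n : ℕ} {q : Matrix (Fin n) (Fin n) ℝ} (hq : qᵀ * q = 1) (A B : Skew n) :
    conjS q (commS A B) = commS (conjS q A) (conjS q B) := by
  have h (M N : Matrix (Fin n) (Fin n) ℝ) :
      q * M * qᵀ * (q * N * qᵀ) = q * (M * N) * qᵀ := by
    calc q * M * qᵀ * (q * N * qᵀ) = q * M * (qᵀ * q) * N * qᵀ := by
          simp only [Matrix.mul_assoc]
      _ = q * (M * N) * qᵀ := by simp only [hq, Matrix.mul_one, Matrix.mul_assoc]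
  apply Subtype.ext
  simp only [conjS, commS, h, Matrix.mul_sub, Matrix.sub_mul]

lemma wedgeCoeff_commBilin {n : ℕ} {a b d : Fin n} (hab : a ≠ b) (hbd : b ≠ d) (had : a ≠ d) :
    wedgeCoeff (commBilin n) a b b d a d = 1 := by
  simp [wedgeCoeff, commBilin, commS, basisWedge, wedgeS, wedge, Matrix.mul_apply,
    Matrix.vecMulVec_apply, Pi.single_apply, hab, had, hbd.symm, had.symm]

/-- Lemma (c) on invariant tensors: for `n ≥ 2`, every alternating bilinear map
`W : skew(n) × skew(n) → skew(n)` satisfying `q W(A,B) qᵀ = W(qAqᵀ, qBqᵀ)` for every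
`q ∈ O(n)` is of the form `W(A,B) = c·[A,B]` for some constant `c`. -/
theorem equivariant_alternating_bilinear_skew_is_commutator (n : ℕ) (hn : 2 ≤ n)
    (W : Skew n →ₗ[ℝ] Skew n →ₗ[ℝ] Skew n)
    (halt : ∀ A : Skew n, W A A = 0)
    (hW : ∀ q : Matrix (Fin n) (Fin n) ℝ, qᵀ * q = 1 →
        ∀ A B : Skew n, conjS q (W A B) = W (conjS q A) (conjS q B)) :
    ∃ c : ℝ, ∀ A B : Skew n, W A B = c • commS A B := by
  obtain ⟨c, hc⟩ : ∃ c : ℝ, Nonempty (Fin 3 ↪ Fin n) → ∃ y : Fin 3 ↪ Fin n,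
      wedgeCoeff (W + (-c) • commBilin n) (y 0) (y 1) (y 1) (y 2) (y 0) (y 2) = 0 := by
    by_cases hne : Nonempty (Fin 3 ↪ Fin n)
    · obtain ⟨y⟩ := hne
      refine ⟨wedgeCoeff W (y 0) (y 1) (y 1) (y 2) (y 0) (y 2), fun _ => ⟨y, ?_⟩⟩
      have h1 := wedgeCoeff_commBilin (y.injective.ne (show (0 : Fin 3) ≠ 1 by decide))
        (y.injective.ne (show (1 : Fin 3) ≠ 2 by decide))
        (y.injective.ne (show (0 : Fin 3) ≠ 2 by decide))
      simp only [wedgeCoeff] at h1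
      simp [wedgeCoeff, h1]
    · exact ⟨0, fun x => (hne x).elim⟩
  have hD : IsConjEquivariant (W + (-c) • commBilin n) := by
    intro q hq A B
    have h1 := congrArg Subtype.val (hW q hq A B)
    have h2 := congrArg Subtype.val (conjS_commS hq A B)
    apply Subtype.ext
    simp only [conjS] at h1 h2
    simp [commBilin, conjS, Matrix.mul_add, Matrix.add_mul, h1, h2]
  refine ⟨c, fun A B => ?_⟩
  have h0 := LinearMap.congr_fun₂ (hD.eq_zero hc) A B
  simpa [commBilin, ← sub_eq_add_neg, sub_eq_zero] using h0
end

section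
/- Let L be a real Lie algebra possessing a basis X₁, X₂, Z₁, Z₂ satisfying [X₁, X₂] = Z₁, [X₁, Z₁] = Z₂, and [X₂, Z₁] = [X₁, Z₂] = [X₂, Z₂] = [Z₁, Z₂] = 0 (the Engel Lie algebra). Then there is no Lie algebra automorphism φ : L → L with φ(X₁) = X₂ and φ(X₂) = −X₁. (Consequently the Engel group is not a sub-Riemannian model space: the rotation by π/2 of the horizontal layer does not extend to an automorphism.) -/
/-- The Engel Lie algebra admits no automorphism `φ` with `φ(X₁) = X₂` and `φ(X₂) = −X₁`:
in any real Lie algebra `L` with a basis `X₁, X₂, Z₁, Z₂` satisfying `[X₁, X₂] = Z₁`,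
`[X₁, Z₁] = Z₂` and all other brackets of basis elements zero, the rotation by `π/2` of
the horizontal layer does not extend to a Lie algebra automorphism. Consequently the
Engel group is not a sub-Riemannian model space. -/
theorem engel_no_rotation_automorphism (L : Type*) [LieRing L] [LieAlgebra ℝ L]
    (X₁ X₂ Z₁ Z₂ : L)
    (hindep : LinearIndependent ℝ ![X₁, X₂, Z₁, Z₂])
    (hspan : Submodule.span ℝ {X₁, X₂, Z₁, Z₂} = ⊤)
    (h1 : ⁅X₁, X₂⁆ = Z₁) (h2 : ⁅X₁, Z₁⁆ = Z₂)
    (h3 : ⁅X₂, Z₁⁆ = 0) (h4 : ⁅X₁, Z₂⁆ = 0) (h5 : ⁅X₂, Z₂⁆ = 0) (h6 : ⁅Z₁, Z₂⁆ = 0) :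
    ¬ ∃ φ : L ≃ₗ[ℝ] L, (∀ u v : L, φ ⁅u, v⁆ = ⁅φ u, φ v⁆) ∧ φ X₁ = X₂ ∧ φ X₂ = -X₁ := by
  rintro ⟨φ, hφ, hX₁, hX₂⟩
  have hZ₁ : φ Z₁ = Z₁ := by
    rw [← h1, hφ, hX₁, hX₂, lie_neg, lie_skew]
  have hZ₂ : φ Z₂ = 0 := by
    rw [← h2, hφ, hX₁, hZ₁, h3]
  exact hindep.ne_zero 3 (φ.map_eq_zero_iff.mp hZ₂)
end

section
/- Let n ≥ 2 and let L be a real Lie algebra possessing a basis X₁, …, Xₙ, Y₁, …, Yₙ, Z satisfying [Xᵢ, Yⱼ] = δᵢⱼ Z and all other brackets of basis elements equal to zero (the n-th Heisenberg Lie algebra 𝔥[n]). Then there is no Lie algebra automorphism φ : L → L with φ(X₁) = X₂ and φ(Y₁) = Y₁. (Consequently, for n ≥ 2 the Heisenberg group H[n] is not a sub-Riemannian model space: the orthogonal map of the horizontal layer sending X₁ to X₂ and fixing Y₁ does not extend to an automorphism.) -/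
/-- For `n ≥ 2`, the `n`-th Heisenberg Lie algebra `𝔥[n]` admits no automorphism `φ` with
`φ(X₁) = X₂` and `φ(Y₁) = Y₁`: in any real Lie algebra `L` with a basis
`X₁, …, Xₙ, Y₁, …, Yₙ, Z` satisfying `[Xᵢ, Yⱼ] = δᵢⱼ Z` and all other brackets of basis
elements zero, the orthogonal map of the horizontal layer sending `X₁` to `X₂` and fixing
`Y₁` does not extend to a Lie algebra automorphism. Consequently, for `n ≥ 2` the
Heisenberg group `H[n]` is not a sub-Riemannian model space. -/
theorem heisenberg_no_automorphism (n : ℕ) (hn : 2 ≤ n)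
    (L : Type*) [LieRing L] [LieAlgebra ℝ L]
    (X Y : Fin n → L) (Z : L)
    (hindep : LinearIndependent ℝ (Sum.elim X (Sum.elim Y (fun _ : Unit => Z))))
    (hspan : Submodule.span ℝ (Set.range (Sum.elim X (Sum.elim Y (fun _ : Unit => Z)))) = ⊤)
    (hXY : ∀ i j, ⁅X i, Y j⁆ = if i = j then Z else 0)
    (hXX : ∀ i j, ⁅X i, X j⁆ = 0) (hYY : ∀ i j, ⁅Y i, Y j⁆ = 0)
    (hZX : ∀ i, ⁅Z, X i⁆ = 0) (hZY : ∀ i, ⁅Z, Y i⁆ = 0) :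
    ¬ ∃ φ : L ≃ₗ[ℝ] L, (∀ u v : L, φ ⁅u, v⁆ = ⁅φ u, φ v⁆) ∧
        φ (X ⟨0, by omega⟩) = X ⟨1, by omega⟩ ∧ φ (Y ⟨0, by omega⟩) = Y ⟨0, by omega⟩ := by
  rintro ⟨φ, hφ, hX, hY⟩
  have hZ : Z ≠ 0 := by simpa using hindep.ne_zero (Sum.inr (Sum.inr ()))
  have h := hφ (X ⟨0, by omega⟩) (Y ⟨0, by omega⟩)
  rw [hX, hY, hXY, hXY, if_pos rfl, if_neg (by simp)] at h
  exact hZ (φ.map_eq_zero_iff.mp h)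
end
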